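/- Repeatedly removing centroid edges from a binary tree with n nodes yields, for any parameter b with 1 ≤ b ≤ n, a partition of the tree into O(b) connected subtrees each of size at most n/b. Precisely: there exists a set of edges whose removal partitions the tree into at most 3b connected components, each with at most ⌈n/b⌉ nodes. -/

import Mathlib

namespace SimpleGraph

variable {V : Type*}

/-- The vertex set of the connected component of `v`. -/
def reachSet (G : SimpleGraph V) (v : V) : Set V := {w | G.Reachable v w}

/-- The vertices still reachable from `u` once the edge between `u` and `v` is deleted. -/
def branch (G : SimpleGraph V) (u v : V) : Set V := (G.deleteEdges {s(u, v)}).reachSet u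

theorem reachSet_eq_of_reachable {G : SimpleGraph V} {u v : V} (h : G.Reachable u v) :
    G.reachSet u = G.reachSet v := by
  ext w
  exact ⟨fun hw => h.symm.trans hw, fun hw => h.trans hw⟩

theorem reachSet_subset_insert_iUnion_branch (G : SimpleGraph V) (u : V) :
    G.reachSet u ⊆ insert u (⋃ w ∈ G.neighborSet u, G.branch w u) := by
  classical
  rintro x ⟨p⟩
  have hp := p.bypass_isPath
  generalize p.bypass = q at hp
  cases q with
  | nil => exact Set.mem_insert _ _
  | @cons _ w _ h q =>
    rw [Walk.cons_isPath_iff] at hp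
    refine Or.inr (Set.mem_biUnion (x := w) h ?_)
    exact ⟨q.toDeleteEdges {s(w, u)} fun e he heq => by
      rw [Set.mem_singleton_iff] at heq
      subst heq
      exact hp.2 (q.snd_mem_support_of_mem_edges he)⟩

theorem IsAcyclic.notMem_branch {G : SimpleGraph V} (hG : G.IsAcyclic) {u v : V}
    (h : G.Adj u v) : v ∉ G.branch u v :=
  isBridge_iff.mp (isAcyclic_iff_forall_adj_isBridge.mp hG h)

theorem IsAcyclic.branch_ssubset {G : SimpleGraph V} (hG : G.IsAcyclic) {u v w : V}
    (hw : G.Adj w u) (hne : w ≠ v) : G.branch w u ⊂ G.branch u v := by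
  have hu := hG.notMem_branch hw
  refine Set.ssubset_iff_subset_ne.mpr ⟨fun x hx => ?_, fun heq => hu (heq ▸ Reachable.refl u)⟩
  have hx' := (reachable_iff_reflTransGen _ _).mp hx
  induction hx' with
  | refl =>
    refine Adj.reachable ?_
    rw [deleteEdges_adj]
    refine ⟨hw.symm, ?_⟩
    simp [hne, hw.ne]
  | @tail y z hy hyz ih =>
    have hyr : y ∈ G.branch w u := (reachable_iff_reflTransGen _ _).mpr hy
    have hyu : y ≠ u := fun h => hu (h ▸ hyr)
    have hzu : z ≠ u := fun h => hu (h ▸ hx)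
    refine (ih hyr).trans (Adj.reachable ?_)
    rw [deleteEdges_adj] at hyz ⊢
    refine ⟨hyz.1, ?_⟩
    simp [hyu, hzu]

theorem ncard_reachSet_le_of_branch_lt [Finite V] {G : SimpleGraph V} {d t : ℕ} {u : V}
    (hdeg : (G.neighborSet u).ncard ≤ d) (h : ∀ w, G.Adj w u → (G.branch w u).ncard < t) :
    (G.reachSet u).ncard ≤ d * (t - 1) + 1 := by
  classical
  have hfin := Set.toFinite (G.neighborSet u)
  calc (G.reachSet u).ncard
      ≤ (insert u (⋃ w ∈ G.neighborSet u, G.branch w u)).ncard :=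
        Set.ncard_le_ncard (G.reachSet_subset_insert_iUnion_branch u) (Set.toFinite _)
    _ ≤ (⋃ w ∈ G.neighborSet u, G.branch w u).ncard + 1 := Set.ncard_insert_le _ _
    _ ≤ d * (t - 1) + 1 := by
      gcongr
      have h1 : (⋃ w ∈ hfin.toFinset, G.branch w u).ncard ≤
          ∑ w ∈ hfin.toFinset, (G.branch w u).ncard :=
        Finset.set_ncard_biUnion_le _ _
      have h2 : ∑ w ∈ hfin.toFinset, (G.branch w u).ncard ≤ hfin.toFinset.card * (t - 1) := by
        rw [← smul_eq_mul]
        refine Finset.sum_le_card_nsmul _ _ _ fun w hw => Nat.le_sub_one_of_lt (h w ?_)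
        exact Adj.symm (hfin.mem_toFinset.mp hw)
      rw [← Set.ncard_eq_toFinset_card _ hfin] at h2
      simp only [Set.Finite.mem_toFinset] at h1
      exact h1.trans (h2.trans (Nat.mul_le_mul_right _ hdeg))

/-- A large component of a forest of bounded degree has an edge both of whose sides are large. -/
theorem IsAcyclic.exists_adj_le_ncard_branch [Finite V] {G : SimpleGraph V} (hG : G.IsAcyclic)
    {d t : ℕ} (hdeg : ∀ v, (G.neighborSet v).ncard ≤ d) {v : V}
    (hv : d * (t - 1) + 1 < (G.reachSet v).ncard) :
    ∃ x y, G.Adj x y ∧ t ≤ (G.branch x y).ncard ∧ t ≤ (G.branch y x).ncard := by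
  by_contra! hcon
  have key : ∀ m : ℕ, ∀ x y, G.Adj x y → d * (t - 1) + 1 < (G.reachSet x).ncard →
      (G.branch x y).ncard = m → m < t := by
    intro m
    induction m using Nat.strong_induction_on with
    | _ m ih =>
      intro x y hxy hx hm
      by_contra! hmt
      refine absurd (ncard_reachSet_le_of_branch_lt (hdeg x) fun w hw => ?_) (not_le.mpr hx)
      by_cases hwy : w = y
      · subst hwy
        exact hcon x w hxy (hm ▸ hmt)
      · refine ih _ ?_ w x hw (reachSet_eq_of_reachable hw.reachable ▸ hx) rfl
        exact hm ▸ Set.ncard_lt_ncard (hG.branch_ssubset hw hwy) (Set.toFinite _)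
  refine absurd (ncard_reachSet_le_of_branch_lt (hdeg v) fun w hw => ?_) (not_le.mpr hv)
  exact key _ w v hw (reachSet_eq_of_reachable hw.reachable ▸ hv) rfl

theorem reachSet_deleteEdges_singleton (G : SimpleGraph V) (x y v : V) :
    (G.deleteEdges {s(x, y)}).reachSet v = G.branch x y ∨
    (G.deleteEdges {s(x, y)}).reachSet v = G.branch y x ∨
    (G.deleteEdges {s(x, y)}).reachSet v = G.reachSet v := by
  by_cases hx : (G.deleteEdges {s(x, y)}).Reachable v x
  · exact Or.inl (reachSet_eq_of_reachable hx)
  by_cases hy : (G.deleteEdges {s(x, y)}).Reachable v y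
  · refine Or.inr (Or.inl ?_)
    rw [branch, Sym2.eq_swap (a := y)]
    exact reachSet_eq_of_reachable hy
  refine Or.inr (Or.inr (Set.Subset.antisymm
    (fun w hw => Reachable.mono (deleteEdges_le _) hw) fun w hw => ?_))
  induction (reachable_iff_reflTransGen _ _).mp hw with
  | refl => exact Reachable.refl v
  | @tail a b ha hab ih =>
    have har := ih ((reachable_iff_reflTransGen _ _).mpr ha)
    refine Reachable.trans har (Adj.reachable ?_)
    rw [deleteEdges_adj]
    refine ⟨hab, fun hmem => ?_⟩
    rcases Sym2.eq_iff.mp (Set.mem_singleton_iff.mp hmem) with ⟨rfl, -⟩ | ⟨rfl, -⟩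
    · exact hx har
    · exact hy har

/-- A tree of maximum degree at most `d` can be cut into components whose sizes lie between `t`
and `d * (t - 1) + 1`. -/
theorem IsTree.exists_deleteEdges_ncard_reachSet [Finite V] {G : SimpleGraph V} (hT : G.IsTree)
    {d t : ℕ} (hdeg : ∀ v, (G.neighborSet v).ncard ≤ d) (ht : t ≤ Nat.card V) :
    ∃ F ⊆ G.edgeSet, ∀ v, t ≤ ((G.deleteEdges F).reachSet v).ncard ∧
      ((G.deleteEdges F).reachSet v).ncard ≤ d * (t - 1) + 1 := by
  have hne : {F : Set (Sym2 V) | F ⊆ G.edgeSet ∧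
      ∀ v, t ≤ ((G.deleteEdges F).reachSet v).ncard}.Nonempty := by
    refine ⟨∅, Set.empty_subset _, fun v => ?_⟩
    have : (G.deleteEdges ∅).reachSet v = Set.univ := by
      rw [deleteEdges_empty]
      exact Set.eq_univ_of_forall fun w => hT.connected.preconnected v w
    rwa [this, Set.ncard_univ]
  obtain ⟨F, ⟨hF, hlow⟩, hmax⟩ := (Set.toFinite _).exists_maximal hne
  refine ⟨F, hF, fun v => ⟨hlow v, ?_⟩⟩
  by_contra! hv
  have hle := G.deleteEdges_le F
  obtain ⟨x, y, hxy, h1, h2⟩ := (hT.isAcyclic.anti hle).exists_adj_le_ncard_branch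
    (fun v => (Set.ncard_le_ncard (fun _ h => hle h) (Set.toFinite _)).trans (hdeg v)) hv
  have hmem : s(x, y) ∈ F := by
    refine hmax (y := F ∪ {s(x, y)}) ⟨Set.union_subset hF ?_, fun w => ?_⟩
      Set.subset_union_left (Or.inr rfl)
    · exact Set.singleton_subset_iff.mpr (hle hxy)
    · rw [← deleteEdges_deleteEdges]
      rcases (G.deleteEdges F).reachSet_deleteEdges_singleton x y w with h | h | h <;> rw [h]
      exacts [h1, h2, hlow w]
  exact (deleteEdges_adj.mp hxy).2 hmem

theorem natCard_connectedComponentMk_fiber (G : SimpleGraph V) (v : V) :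
    Nat.card {w : V // G.connectedComponentMk w = G.connectedComponentMk v} =
      (G.reachSet v).ncard := by
  rw [← Nat.card_coe_set_eq]
  exact Nat.card_congr (Equiv.subtypeEquivRight fun w =>
    ConnectedComponent.eq.trans reachable_comm)

theorem natCard_connectedComponent_mul_le [Finite V] {G : SimpleGraph V} {t : ℕ}
    (h : ∀ v, t ≤ (G.reachSet v).ncard) : Nat.card G.ConnectedComponent * t ≤ Nat.card V := by
  classical
  have := Fintype.ofFinite G.ConnectedComponent
  rw [Nat.card_congr (Equiv.sigmaFiberEquiv G.connectedComponentMk).symm, Nat.card_sigma,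
    Nat.card_eq_fintype_card, ← Finset.card_univ, ← smul_eq_mul]
  refine Finset.card_nsmul_le_sum _ _ _ fun c _ => ?_
  induction c using ConnectedComponent.ind with
  | _ v => exact (h v).trans_eq (G.natCard_connectedComponentMk_fiber v).symm

end SimpleGraph

/-- Repeatedly removing centroid edges: for every tree of maximum degree `3`
(i.e. a rooted binary tree viewed as an undirected graph) on `n` vertices and any
`1 ≤ b ≤ n`, there is a set of edges whose removal leaves at most `3b` connected
components, each containing at most `⌈n/b⌉` vertices. -/
theorem tree_partition_into_blocks {V : Type*} [Fintype V] [DecidableEq V]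
    (G : SimpleGraph V) (hT : G.IsTree) (hdeg : ∀ v : V, (G.neighborSet v).ncard ≤ 3)
    (b : ℕ) (hb1 : 1 ≤ b) (hb2 : b ≤ Fintype.card V) :
    ∃ F ⊆ G.edgeSet,
      Nat.card (G.deleteEdges F).ConnectedComponent ≤ 3 * b ∧
      ∀ c : (G.deleteEdges F).ConnectedComponent,
        Nat.card {v : V // (G.deleteEdges F).connectedComponentMk v = c} ≤
          (Fintype.card V + b - 1) / b := by
  set n := Fintype.card V with hn
  set k := (n + b - 1) / b with hk
  have hk1 : 1 ≤ k := (Nat.le_div_iff_mul_le hb1).mpr (by lia)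
  have hkn : k ≤ n := by
    refine Nat.div_le_of_le_mul ?_
    obtain ⟨c, rfl⟩ := Nat.exists_eq_add_of_le hb1
    nlinarith [Nat.sub_add_cancel (show 1 ≤ n + (1 + c) by lia)]
  have hnk : n ≤ k * b := by
    have := Nat.lt_div_mul_add (a := n + b - 1) hb1
    rw [← hk] at this
    lia
  obtain ⟨F, hF, h⟩ := hT.exists_deleteEdges_ncard_reachSet (t := (k + 2) / 3) hdeg
    (by rw [Nat.card_eq_fintype_card]; lia)
  refine ⟨F, hF, ?_, fun c => ?_⟩
  · have hm := SimpleGraph.natCard_connectedComponent_mul_le fun v => (h v).1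
    rw [Nat.card_eq_fintype_card (α := V), ← hn] at hm
    by_contra! hlt
    have h3 : k ≤ 3 * ((k + 2) / 3) := by lia
    have h4 : 1 ≤ (k + 2) / 3 := by lia
    nlinarith [Nat.mul_le_mul_right ((k + 2) / 3) hlt, Nat.mul_le_mul_right b h3]
  · induction c using SimpleGraph.ConnectedComponent.ind with
    | _ v =>
      rw [SimpleGraph.natCard_connectedComponentMk_fiber]
      exact (h v).2.trans (by lia)
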